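/- Let (G, p, L) be a minimum counterexample, minimizing the number of vertices and edges of G, to the following statement: 'Every plane graph G with no 5-cycle and no 6-cycle, with p ∈ V(G) and L a (*,1)-list assignment with |L(p)| = 1 and |L(v)| = 3 for all v ≠ p, is L-colorable.' Then G is 2-connected, every vertex v ∈ V(G) other than p has degree at least 3, and p has degree at least 2. -/

import Mathlib

open Set

namespace ChoosSep

/-- `G` has a cycle of length `n`. -/
def HasCycleLen {V : Type} (G : SimpleGraph V) (n : ℕ) : Prop :=
  ∃ (v : V) (c : G.Walk v v), c.IsCycle ∧ c.length = n

/-- `G` has a proper coloring choosing each color from the list `L v`. -/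
def ColorableWith {V : Type} (G : SimpleGraph V) (L : V → Finset ℕ) : Prop :=
  ∃ φ : V → ℕ, (∀ v, φ v ∈ L v) ∧ ∀ ⦃u v⦄, G.Adj u v → φ u ≠ φ v

/-- `G` is `(k,d)`-choosable: it has an `L`-coloring for every list assignment
giving each vertex at least `k` colors and any two adjacent vertices at most `d`
common colors. -/
def Choosable {V : Type} (G : SimpleGraph V) (k d : ℕ) : Prop :=
  ∀ L : V → Finset ℕ, (∀ v, k ≤ (L v).card) →
    (∀ ⦃u v⦄, G.Adj u v → ((L u) ∩ (L v)).card ≤ d) →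
    ColorableWith G L

/-- The closed straight segment between two points of the plane. -/
def seg (x y : ℝ × ℝ) : Set (ℝ × ℝ) := segment ℝ x y

/-- A straight-line plane embedding of `G`: vertices go to distinct points, edges are
drawn as straight segments, two distinct edges meet only in common endpoints, and no
vertex lies on the drawing of an edge it does not belong to.  By Fáry's theorem a
finite simple graph admits such an embedding iff it is planar. -/
structure PlaneEmb {V : Type} (G : SimpleGraph V) where
  pos : V → ℝ × ℝ
  inj : Function.Injective pos
  edges_meet : ∀ ⦃a b c d : V⦄, G.Adj a b → G.Adj c d → s(a, b) ≠ s(c, d) →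
    seg (pos a) (pos b) ∩ seg (pos c) (pos d) ⊆ ({pos a, pos b} ∩ {pos c, pos d} : Set (ℝ × ℝ))
  vertex_off : ∀ ⦃a b v : V⦄, G.Adj a b → v ≠ a → v ≠ b → pos v ∉ seg (pos a) (pos b)

/-- `G` is planar: it admits a plane embedding. -/
def IsPlanar {V : Type} (G : SimpleGraph V) : Prop := Nonempty (PlaneEmb G)

variable {V : Type} {G : SimpleGraph V}

/-- The drawing of the graph in the plane: all vertex points and all edge segments. -/
def PlaneEmb.drawing (E : PlaneEmb G) : Set (ℝ × ℝ) :=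
  Set.range E.pos ∪ ⋃ (a : V) (b : V) (_ : G.Adj a b), seg (E.pos a) (E.pos b)

/-- A face of the embedding: a connected component of the complement of the drawing. -/
def PlaneEmb.IsFace (E : PlaneEmb G) (C : Set (ℝ × ℝ)) : Prop :=
  ∃ q, q ∉ E.drawing ∧ C = connectedComponentIn E.drawingᶜ q

/-- The outer face: the unbounded face. -/
def PlaneEmb.IsOuterFace (E : PlaneEmb G) (C : Set (ℝ × ℝ)) : Prop :=
  E.IsFace C ∧ ¬ Bornology.IsBounded C

/-- The vertices lying on the boundary of the face `C`. -/
def PlaneEmb.onFace (E : PlaneEmb G) (C : Set (ℝ × ℝ)) : Set V :=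
  {v | E.pos v ∈ closure C}

/-- An edge of `G` lying on the boundary of the face `C`. -/
def PlaneEmb.BoundaryEdge (E : PlaneEmb G) (C : Set (ℝ × ℝ)) (u v : V) : Prop :=
  G.Adj u v ∧ seg (E.pos u) (E.pos v) ⊆ closure C

/-- `C` is a 3-face with (mutually adjacent) incident vertices `x`, `y`, `z`. -/
def PlaneEmb.IsTriFace (E : PlaneEmb G) (C : Set (ℝ × ℝ)) (x y z : V) : Prop :=
  E.IsFace C ∧ G.Adj x y ∧ G.Adj y z ∧ G.Adj x z ∧
    frontier C = seg (E.pos x) (E.pos y) ∪ seg (E.pos y) (E.pos z) ∪ seg (E.pos x) (E.pos z)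

/-- `C` is a 4-face with incident 4-cycle `w x y z`. -/
def PlaneEmb.IsQuadFace (E : PlaneEmb G) (C : Set (ℝ × ℝ)) (w x y z : V) : Prop :=
  E.IsFace C ∧ G.Adj w x ∧ G.Adj x y ∧ G.Adj y z ∧ G.Adj z w ∧ w ≠ y ∧ x ≠ z ∧
    frontier C = seg (E.pos w) (E.pos x) ∪ seg (E.pos x) (E.pos y) ∪
      seg (E.pos y) (E.pos z) ∪ seg (E.pos z) (E.pos w)

/-- `x z1 y z2` is a diamond: a 4-cycle formed by two adjacent 3-faces
`x y z1` and `x y z2` sharing the edge `x y`. -/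
def PlaneEmb.IsDiamond (E : PlaneEmb G) (x z1 y z2 : V) : Prop :=
  z1 ≠ z2 ∧ ∃ C1 C2 : Set (ℝ × ℝ), C1 ≠ C2 ∧ E.IsTriFace C1 x y z1 ∧ E.IsTriFace C2 x y z2

/-- The union of the three sides of the triangle `a b c`. -/
def triBoundary (a b c : ℝ × ℝ) : Set (ℝ × ℝ) := seg a b ∪ seg b c ∪ seg a c

/-- The open interior region of the triangle `a b c`: points off the triangle whose
connected component in the complement of the triangle is bounded. -/
def triInterior (a b c : ℝ × ℝ) : Set (ℝ × ℝ) :=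
  {p | p ∉ triBoundary a b c ∧
    Bornology.IsBounded (connectedComponentIn (triBoundary a b c)ᶜ p)}

/-- The degree of a vertex. -/
noncomputable def deg (G : SimpleGraph V) (v : V) : ℕ := Nat.card {u : V // G.Adj v u}

/-- `G` is 2-connected: connected and with no cutvertex. -/
def TwoConnected (G : SimpleGraph V) : Prop :=
  G.Connected ∧ ∀ v : V, (G.induce {u : V | u ≠ v}).Connected

/-- A configuration for Theorem 8: a plane graph with no 5-cycle and no 6-cycle, a
vertex `p`, and a `(*,1)`-list assignment with `|L(p)| = 1` and `|L(v)| = 3`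
for every other vertex. -/
structure Cfg56 where
  n : ℕ
  G : SimpleGraph (Fin n)
  E : PlaneEmb G
  p : Fin n
  L : Fin n → Finset ℕ

namespace Cfg56

/-- All hypotheses of Theorem 8 hold for the configuration. -/
def Valid (C : Cfg56) : Prop :=
  (¬ HasCycleLen C.G 5) ∧ (¬ HasCycleLen C.G 6) ∧
  (∀ ⦃u v⦄, C.G.Adj u v → ((C.L u) ∩ (C.L v)).card ≤ 1) ∧
  (C.L C.p).card = 1 ∧
  (∀ v, v ≠ C.p → (C.L v).card = 3)

/-- The configuration admits an `L`-coloring. -/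
def Colorable (C : Cfg56) : Prop := ColorableWith C.G C.L

/-- The quantity `|V(G)| + |E(G)|`. -/
noncomputable def measure (C : Cfg56) : ℕ := C.n + Nat.card ↥C.G.edgeSet

/-- `C` is a minimum counterexample to Theorem 8: it satisfies the hypotheses, has no
`L`-coloring, and minimizes `|V(G)| + |E(G)|` among all such counterexamples. -/
def MinCounterexample (C : Cfg56) : Prop :=
  C.Valid ∧ ¬ C.Colorable ∧
    ∀ D : Cfg56, D.Valid → ¬ D.Colorable → C.measure ≤ D.measure

end Cfg56

namespace PlaneEmb

/-- A plane embedding of `G` restricts to any graph pulled back along an injection. -/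
def comap {V W : Type} {G : SimpleGraph V} (E : PlaneEmb G) (f : W ↪ V) :
    PlaneEmb (G.comap f) where
  pos := E.pos ∘ f
  inj := E.inj.comp f.injective
  edges_meet := by
    intro a b c d hab hcd hne
    refine E.edges_meet (a := f a) (b := f b) (c := f c) (d := f d) hab hcd fun h => hne ?_
    exact Sym2.map.injective f.injective (by simpa using h)
  vertex_off := by
    intro a b v hab hva hvb
    exact E.vertex_off (a := f a) (b := f b) (v := f v) hab
      (f.injective.ne hva) (f.injective.ne hvb)

end PlaneEmb

theorem HasCycleLen.of_comap {V W : Type} {G : SimpleGraph V} (f : W ↪ V) {n : ℕ}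
    (h : HasCycleLen (G.comap f) n) : HasCycleLen G n := by
  obtain ⟨v, c, hc, hn⟩ := h
  exact ⟨f v, c.map (SimpleGraph.Embedding.comap f G).toHom, hc.map f.injective, (c.length_map _).trans hn⟩

theorem card_edgeSet_comap_le {V W : Type} [Finite V] (G : SimpleGraph V) (f : W ↪ V) :
    Nat.card (G.comap f).edgeSet ≤ Nat.card G.edgeSet :=
  Nat.card_le_card_of_injective _ (SimpleGraph.Embedding.comap f G).mapEdgeSet.injective

namespace Cfg56.MinCounterexample

variable {C : Cfg56}

/-- Every proper vertex subset `S` of a minimum counterexample can be colored from the given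
lists, with the color of one vertex `q ∈ S` prescribed, where `q = p` if `p ∈ S`. -/
theorem exists_coloring_on (hC : C.MinCounterexample) {S : Set (Fin C.n)} (hS : S ≠ univ)
    {q : Fin C.n} (hq : q ∈ S) (hp : C.p ∈ S → q = C.p) {c : ℕ} (hc : c ∈ C.L q) :
    ∃ φ : Fin C.n → ℕ, φ q = c ∧ (∀ v ∈ S, φ v ∈ C.L v) ∧
      ∀ u ∈ S, ∀ v ∈ S, C.G.Adj u v → φ u ≠ φ v := by
  classical
  obtain ⟨⟨h5, h6, hsep, hp1, h3⟩, -, hmin⟩ := hC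
  let e : Fin (Nat.card S) ≃ S := (Finite.equivFin S).symm
  let f : Fin (Nat.card S) ↪ Fin C.n := e.toEmbedding.trans (Function.Embedding.subtype _)
  have hfS (i) : f i ∈ S := (e i).2
  have hfe (v : S) : f (e.symm v) = v :=
    congrArg Subtype.val (e.apply_symm_apply v)
  let L' : Fin C.n → Finset ℕ := Function.update C.L q {c}
  have hL'q : L' q = {c} := Function.update_self ..
  have hL' (v) : L' v ⊆ C.L v := by
    by_cases h : v = q
    · subst h
      simpa [hL'q] using hc
    · simp [L', h]
  let D : Cfg56 := ⟨Nat.card S, C.G.comap f, C.E.comap f, e.symm ⟨q, hq⟩, L' ∘ f⟩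
  have hD : D.Valid := by
    refine ⟨fun h => h5 (h.of_comap f), fun h => h6 (h.of_comap f), ?_, ?_, ?_⟩
    · intro u v huv
      exact (Finset.card_le_card (Finset.inter_subset_inter (hL' _) (hL' _))).trans
        (hsep (u := f u) (v := f v) huv)
    · change (L' (f (e.symm ⟨q, hq⟩))).card = 1
      rw [hfe, hL'q, Finset.card_singleton]
    · intro i hi
      have hiq : f i ≠ q := fun h => hi (f.injective (by rw [h]; exact (hfe ⟨q, hq⟩).symm))
      change (L' (f i)).card = 3
      rw [show L' (f i) = C.L (f i) from Function.update_of_ne hiq ..]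
      exact h3 _ fun h => hiq (h.trans (hp (h ▸ hfS i)).symm)
  have hcard : Nat.card S < C.n := by
    have := Set.ncard_lt_card hS
    rwa [Nat.card_fin] at this
  have hcol : D.Colorable := by
    by_contra h
    have hle : C.n + _ ≤ Nat.card S + _ := hmin D hD h
    have := card_edgeSet_comap_le C.G f
    change _ ≤ _ + Nat.card (C.G.comap f).edgeSet at hle
    omega
  obtain ⟨ψ, hψL, hψ⟩ := hcol
  have key (v) (hv : v ∈ S) : ψ (e.symm ⟨v, hv⟩) ∈ L' v := by
    have : ψ _ ∈ L' (f _) := hψL (e.symm ⟨v, hv⟩)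
    rwa [hfe] at this
  refine ⟨fun v => if hv : v ∈ S then ψ (e.symm ⟨v, hv⟩) else 0, ?_, ?_, ?_⟩
  · simpa [hq, hL'q] using key q hq
  · intro v hv
    simpa [hv] using hL' v (key v hv)
  · intro u hu v hv huv
    simp only [hu, hv, dif_pos]
    refine hψ ?_
    change C.G.Adj (f _) (f _)
    rwa [hfe, hfe]

theorem list_nonempty (hC : C.MinCounterexample) (v : Fin C.n) : (C.L v).Nonempty := by
  obtain ⟨⟨-, -, -, h1, h3⟩, -⟩ := hC
  rw [← Finset.card_pos]
  by_cases h : v = C.p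
  · rw [h]; omega
  · rw [h3 v h]; omega

/-- A coloring of `G - v` leaves no color of `L v` free at `v`. -/
theorem exists_adj_eq (hC : C.MinCounterexample) {v : Fin C.n} {φ : Fin C.n → ℕ}
    (hL : ∀ u ∈ ({v}ᶜ : Set (Fin C.n)), φ u ∈ C.L u)
    (hφ : ∀ u ∈ ({v}ᶜ : Set (Fin C.n)), ∀ w ∈ ({v}ᶜ : Set (Fin C.n)), C.G.Adj u w → φ u ≠ φ w)
    {c : ℕ} (hc : c ∈ C.L v) : ∃ u, C.G.Adj v u ∧ φ u = c := by
  by_contra! h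
  refine hC.2.1 ⟨Function.update φ v c, fun u => ?_, fun u w huw => ?_⟩
  · by_cases hu : u = v
    · subst hu
      simpa using hc
    · simpa [hu] using hL u hu
  · by_cases hu : u = v
    · subst hu
      simpa [huw.ne'] using (h w huw).symm
    · by_cases hw : w = v
      · subst hw
        simpa [hu] using h u huw.symm
      · simpa [hu, hw] using hφ u hu w hw huw

theorem three_le_deg (hC : C.MinCounterexample) {v : Fin C.n} (hv : v ≠ C.p) :
    3 ≤ deg C.G v := by
  obtain ⟨c, hc⟩ := hC.list_nonempty C.p
  obtain ⟨φ, -, hL, hφ⟩ := hC.exists_coloring_on (S := {v}ᶜ) (by simp) (q := C.p)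
    (by simpa using hv.symm) (fun _ => rfl) hc
  choose g hg hgc using fun c : C.L v => hC.exists_adj_eq hL hφ c.2
  have hinj : Function.Injective
      (fun c => ⟨g c, hg c⟩ : C.L v → {u : Fin C.n // C.G.Adj v u}) := by
    intro a b hab
    have hab' : g a = g b := congrArg Subtype.val hab
    exact Subtype.ext (by rw [← hgc a, ← hgc b, hab'])
  have := Nat.card_le_card_of_injective _ hinj
  rwa [Nat.card_eq_finsetCard, hC.1.2.2.2.2 v hv] at this

theorem exists_ne (hC : C.MinCounterexample) : ∃ u, u ≠ C.p := by
  by_contra! h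
  refine hC.2.1 ⟨fun v => (hC.list_nonempty v).choose,
    fun v => (hC.list_nonempty v).choose_spec, fun u v huv => ?_⟩
  exact absurd ((h u).trans (h v).symm) huv.ne

theorem two_le_deg (hC : C.MinCounterexample) : 2 ≤ deg C.G C.p := by
  by_contra! hdeg
  obtain ⟨u, hup, hu⟩ : ∃ u, u ≠ C.p ∧ ∀ w, C.G.Adj C.p w → w = u := by
    by_cases h : ∃ u, C.G.Adj C.p u
    · obtain ⟨u, hu⟩ := h
      have : Subsingleton {u : Fin C.n // C.G.Adj C.p u} :=
        Finite.card_le_one_iff_subsingleton.mp (Nat.le_of_lt_succ hdeg)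
      exact ⟨u, hu.ne', fun w hw =>
        congrArg Subtype.val (Subsingleton.elim (⟨w, hw⟩ : {u // C.G.Adj C.p u}) ⟨u, hu⟩)⟩
    · push Not at h
      obtain ⟨u, hu⟩ := hC.exists_ne
      exact ⟨u, hu, fun w hw => absurd hw (h w)⟩
  obtain ⟨c, hcu, hcp⟩ : ∃ c ∈ C.L u, c ∉ C.L C.p :=
    Finset.exists_mem_notMem_of_card_lt_card
      (by rw [hC.1.2.2.2.1, hC.1.2.2.2.2 u hup]; omega)
  obtain ⟨φ, hφu, hL, hφ⟩ := hC.exists_coloring_on (S := {C.p}ᶜ) (by simp)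
    (q := u) hup (fun h => absurd rfl h) hcu
  obtain ⟨d, hd⟩ := hC.list_nonempty C.p
  obtain ⟨w, hw, hwd⟩ := hC.exists_adj_eq hL hφ hd
  rw [hu w hw, hφu] at hwd
  exact hcp (hwd ▸ hd)

/-- A minimum counterexample has no separation of order at most one. -/
theorem false_of_separation (hC : C.MinCounterexample) {A B : Set (Fin C.n)} (hA : A ≠ univ)
    (hB : B ≠ univ) (hcov : A ∪ B = univ) (hp : C.p ∈ A) {q : Fin C.n} (hq : q ∈ B)
    (hAB : A ∩ B ⊆ {q}) (hadj : ∀ u v, C.G.Adj u v → u ∈ A → v ∉ A → u ∈ B) : False := by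
  classical
  obtain ⟨d, hd⟩ := hC.list_nonempty C.p
  obtain ⟨φ, -, hφL, hφ⟩ := hC.exists_coloring_on hA hp (fun _ => rfl) hd
  obtain ⟨c, hcL, hc⟩ : ∃ c ∈ C.L q, q ∈ A → φ q = c := by
    by_cases h : q ∈ A
    · exact ⟨φ q, hφL q h, fun _ => rfl⟩
    · obtain ⟨c, hc⟩ := hC.list_nonempty q
      exact ⟨c, hc, fun h' => absurd h' h⟩
  obtain ⟨ψ, hψq, hψL, hψ⟩ := hC.exists_coloring_on hB hq
    (fun h => (hAB ⟨hp, h⟩).symm) hcL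
  have hmemB {v} (hv : v ∉ A) : v ∈ B := (hcov ▸ mem_univ v : v ∈ A ∪ B).resolve_left hv
  have hagree {v} (hv : v ∈ B) : (if v ∈ A then φ v else ψ v) = ψ v := by
    split_ifs with h
    · obtain rfl : v = q := hAB ⟨h, hv⟩
      rw [hc h, hψq]
    · rfl
  refine hC.2.1 ⟨fun v => if v ∈ A then φ v else ψ v, fun v => ?_, fun u v huv => ?_⟩
  · dsimp only
    split_ifs with h
    · exact hφL v h
    · exact hψL v (hmemB h)
  · by_cases hAA : u ∈ A ∧ v ∈ A
    · simpa [hAA.1, hAA.2] using hφ u hAA.1 v hAA.2 huv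
    · have hu : u ∈ B := by
        by_cases h : u ∈ A
        · exact hadj u v huv h fun hv => hAA ⟨h, hv⟩
        · exact hmemB h
      have hv : v ∈ B := by
        by_cases h : v ∈ A
        · exact hadj v u huv.symm h fun hu => hAA ⟨hu, h⟩
        · exact hmemB h
      dsimp only
      rw [hagree hu, hagree hv]
      exact hψ u hu v hv huv

theorem connected (hC : C.MinCounterexample) : C.G.Connected := by
  rw [SimpleGraph.connected_iff_exists_forall_reachable]
  by_contra! h
  obtain ⟨b, hb⟩ := h C.p
  let A : Set (Fin C.n) := {v | C.G.Reachable C.p v}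
  have hp : C.p ∈ A := SimpleGraph.Reachable.refl _
  exact hC.false_of_separation (A := A) (B := Aᶜ) (q := b)
    (fun h => hb (h ▸ mem_univ b : b ∈ A)) (fun h => (h ▸ mem_univ C.p : C.p ∈ Aᶜ) hp)
    (union_compl_self A) hp hb (by simp)
    fun u v huv hu hv => absurd (SimpleGraph.Reachable.trans hu huv.reachable) hv

theorem induce_ne_connected (hC : C.MinCounterexample) (v : Fin C.n) :
    (C.G.induce {u | u ≠ v}).Connected := by
  obtain ⟨a, hav, hpa⟩ : ∃ a, a ≠ v ∧ (C.p = v ∨ C.p = a) := by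
    by_cases h : C.p = v
    · obtain ⟨a, ha⟩ := hC.exists_ne
      exact ⟨a, h ▸ ha, Or.inl h⟩
    · exact ⟨C.p, h, Or.inr rfl⟩
  rw [SimpleGraph.connected_iff_exists_forall_reachable]
  by_contra! h
  obtain ⟨⟨b, hbv⟩, hb⟩ := h ⟨a, hav⟩
  let K : Set (Fin C.n) := {u | ∃ hu : u ≠ v, (C.G.induce {u | u ≠ v}).Reachable ⟨a, hav⟩ ⟨u, hu⟩}
  have haK : a ∈ K := ⟨hav, SimpleGraph.Reachable.refl _⟩
  have hbK : b ∉ K := fun ⟨_, h⟩ => hb h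
  refine hC.false_of_separation (A := insert v K) (B := Kᶜ) (q := v) ?_ ?_ ?_ ?_ ?_ ?_ ?_
  · exact fun h => (h ▸ mem_univ b : b ∈ insert v K).elim hbv hbK
  · exact fun h => (h ▸ mem_univ a : a ∈ Kᶜ) haK
  · rw [insert_union, union_compl_self, insert_eq_of_mem (mem_univ v)]
  · exact hpa.imp id fun h => (by rwa [h])
  · exact fun h => h.1 rfl
  · exact fun w hw => hw.1.resolve_right hw.2
  · rintro u w huw - hw ⟨hu, hur⟩
    rw [mem_insert_iff, not_or] at hw
    refine hw.2 ⟨hw.1, hur.trans (SimpleGraph.Adj.reachable ?_)⟩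
    exact huw

end Cfg56.MinCounterexample

/-- **Basic properties of a minimum counterexample to Theorem 8.** Such a graph is
2-connected, every vertex other than `p` has degree at least 3, and `p` has degree
at least 2. -/
theorem min_cex_C5C6free_basic (C : Cfg56) (hC : C.MinCounterexample) :
    TwoConnected C.G ∧ (∀ v : Fin C.n, v ≠ C.p → 3 ≤ deg C.G v) ∧ 2 ≤ deg C.G C.p :=
  ⟨⟨hC.connected, hC.induce_ne_connected⟩, fun _ hv => hC.three_le_deg hv, hC.two_le_deg⟩

end ChoosSep
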